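/- arXiv:2004.08093 — 2 statements merged into one kernel-verified Lean document; each statement's English description precedes it below -/
import Mathlib

section
/- Let a >= 1 be an integer. The starlike tree T(a, a+1, a+2) with three arms of lengths a, a+1 and a+2 is transmission irregular if and only if a is odd. -/
/-- The transmission of a vertex `v`: the sum of distances from `v` to all vertices. -/
noncomputable def transmission {V : Type*} [Fintype V] (G : SimpleGraph V) (v : V) : ℕ :=
  ∑ u, G.dist v u

/-- A graph is transmission irregular if all vertices have pairwise distinct transmissions. -/
def TransmissionIrregular {V : Type*} [Fintype V] (G : SimpleGraph V) : Prop :=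
  Function.Injective (transmission G)

/-- The starlike tree `T(k 0, …, k (t-1))`: a central vertex (`none`) with `t` pendant
paths attached, the `i`-th of length `k i`; `some ⟨i, j⟩` is the vertex at distance
`j + 1` from the center on the `i`-th arm. -/
def starlike (t : ℕ) (k : Fin t → ℕ) :
    SimpleGraph (Option (Σ i : Fin t, Fin (k i))) :=
  SimpleGraph.fromRel (fun x y =>
    (∃ i : Fin t, ∃ j : Fin (k i), x = none ∧ y = some ⟨i, j⟩ ∧ (j : ℕ) = 0) ∨
    (∃ i : Fin t, ∃ j j' : Fin (k i), x = some ⟨i, j⟩ ∧ y = some ⟨i, j'⟩ ∧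
      (j' : ℕ) = (j : ℕ) + 1))

/-- A function on the vertices that vanishes only at `x`, grows by at most one along each edge and
can be decreased by one at every vertex where it is positive is the distance from `x`. -/
theorem SimpleGraph.dist_eq_of_potential {V : Type*} (G : SimpleGraph V) (x : V) (g : V → ℕ)
    (h_zero : ∀ y, g y = 0 ↔ y = x) (h_lip : ∀ y z, G.Adj y z → g z ≤ g y + 1)
    (h_desc : ∀ y n, g y = n + 1 → ∃ z, G.Adj z y ∧ g z = n) (y : V) :
    G.dist x y = g y := by
  have h_walk : ∀ n y, g y = n → ∃ p : G.Walk x y, p.length = n := by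
    intro n
    induction n with
    | zero =>
      intro y hy
      obtain rfl := (h_zero y).1 hy
      exact ⟨.nil, rfl⟩
    | succ n ih =>
      intro y hy
      obtain ⟨z, hzy, hz⟩ := h_desc y n hy
      obtain ⟨p, hp⟩ := ih z hz
      exact ⟨p.concat hzy, by simp [hp]⟩
  have h_le : ∀ u v (p : G.Walk u v), g v ≤ g u + p.length := by
    intro u v p
    induction p with
    | nil => simp
    | cons h p ih =>
      have := h_lip _ _ h
      rw [SimpleGraph.Walk.length_cons]
      omega
  obtain ⟨p, hp⟩ := h_walk _ y rfl
  obtain ⟨q, hq⟩ := p.reachable.exists_walk_length_eq_dist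
  have hpd := G.dist_le p
  have hqg := h_le _ _ q
  rw [(h_zero x).2 rfl] at hqg
  omega

/-- The closed form of the distance in a starlike tree. -/
def starlikeDist {t : ℕ} {k : Fin t → ℕ} :
    Option (Σ i : Fin t, Fin (k i)) → Option (Σ i : Fin t, Fin (k i)) → ℕ
  | none, none => 0
  | none, some v => v.2 + 1
  | some u, none => u.2 + 1
  | some u, some v =>
    if u.1 = v.1 then (u.2 - v.2 : ℕ) + (v.2 - u.2 : ℕ) else u.2 + v.2 + 2

section Starlike

variable {t : ℕ} {k : Fin t → ℕ}

theorem starlike_adj_none_some {i : Fin t} {j : Fin (k i)} :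
    (starlike t k).Adj none (some ⟨i, j⟩) ↔ (j : ℕ) = 0 := by
  simp only [starlike, SimpleGraph.fromRel_adj]
  constructor
  · rintro ⟨-, (⟨i', j', -, h, h0⟩ | ⟨_, _, _, h, -⟩) | (⟨_, _, h, -⟩ | ⟨_, _, _, -, h, -⟩)⟩
    · cases h
      exact h0
    all_goals cases h
  · intro h
    exact ⟨by simp, .inl (.inl ⟨i, j, trivial, rfl, h⟩)⟩

theorem starlike_adj_some_some {i i' : Fin t} {j : Fin (k i)} {j' : Fin (k i')} :
    (starlike t k).Adj (some ⟨i, j⟩) (some ⟨i', j'⟩) ↔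
      i = i' ∧ ((j' : ℕ) = j + 1 ∨ (j : ℕ) = j' + 1) := by
  simp only [starlike, SimpleGraph.fromRel_adj]
  constructor
  · rintro ⟨-, (⟨_, _, h, -⟩ | ⟨_, _, _, h, h', e⟩) | (⟨_, _, h, -⟩ | ⟨_, _, _, h, h', e⟩)⟩
    · cases h
    · cases h; cases h'
      exact ⟨rfl, .inl e⟩
    · cases h
    · cases h; cases h'
      exact ⟨rfl, .inr e⟩
  · rintro ⟨rfl, h⟩
    refine ⟨?_, ?_⟩
    · intro e
      cases e
      omega
    · rcases h with h | h
      · exact .inl (.inr ⟨i, j, j', rfl, rfl, h⟩)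
      · exact .inr (.inr ⟨i, j', j, rfl, rfl, h⟩)

theorem starlike_dist (x y : Option (Σ i : Fin t, Fin (k i))) :
    (starlike t k).dist x y = starlikeDist x y := by
  apply SimpleGraph.dist_eq_of_potential
  · rintro (_ | ⟨i', j'⟩) <;> rcases x with _ | ⟨i, j⟩
    · simp [starlikeDist]
    · simp [starlikeDist]
    · simp [starlikeDist]
    · by_cases h : i = i'
      · subst h
        simp only [starlikeDist, if_true, Option.some.injEq, Sigma.mk.injEq, heq_eq_eq, true_and,
          Fin.ext_iff]
        omega
      · simp [starlikeDist, h, Ne.symm h]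
  · rintro (_ | ⟨i', j'⟩) (_ | ⟨i'', j''⟩) hadj
    · exact absurd rfl hadj.ne
    · rw [starlike_adj_none_some] at hadj
      rcases x with _ | ⟨i, j⟩ <;> simp only [starlikeDist]
      · omega
      · split_ifs <;> omega
    · rw [SimpleGraph.adj_comm, starlike_adj_none_some] at hadj
      rcases x with _ | ⟨i, j⟩ <;> simp only [starlikeDist]
      · omega
      · split_ifs <;> omega
    · rw [starlike_adj_some_some] at hadj
      obtain ⟨rfl, hadj⟩ := hadj
      rcases x with _ | ⟨i, j⟩ <;> simp only [starlikeDist]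
      · omega
      · split_ifs <;> omega
  · have h_in : ∀ (i : Fin t) (j : Fin (k i)), (j : ℕ) ≠ 0 →
        ∃ j' : Fin (k i), (j' : ℕ) + 1 = j := fun i j hj =>
      ⟨⟨j - 1, by omega⟩, Nat.sub_add_cancel (Nat.pos_of_ne_zero hj)⟩
    rintro (_ | ⟨i', j'⟩) n hn <;> rcases x with _ | ⟨i, j⟩
    · simp [starlikeDist] at hn
    · simp only [starlikeDist] at hn
      refine ⟨some ⟨i, ⟨0, by omega⟩⟩, ?_, ?_⟩
      · rw [SimpleGraph.adj_comm, starlike_adj_none_some]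
      · simp only [starlikeDist, if_true]
        omega
    · simp only [starlikeDist] at hn
      by_cases h0 : (j' : ℕ) = 0
      · exact ⟨none, starlike_adj_none_some.2 h0, by simp only [starlikeDist]; omega⟩
      · obtain ⟨l, hl⟩ := h_in i' j' h0
        exact ⟨some ⟨i', l⟩, starlike_adj_some_some.2 ⟨rfl, by omega⟩,
          by simp only [starlikeDist]; omega⟩
    · by_cases h : i = i'
      · subst h
        simp only [starlikeDist, if_true] at hn
        by_cases hlt : (j : ℕ) < j'
        · obtain ⟨l, hl⟩ := h_in i j' (by omega)
          exact ⟨some ⟨i, l⟩, starlike_adj_some_some.2 ⟨rfl, by omega⟩,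
            by simp only [starlikeDist, if_true]; omega⟩
        · exact ⟨some ⟨i, ⟨j' + 1, by omega⟩⟩, starlike_adj_some_some.2 ⟨rfl, by simp⟩,
            by simp only [starlikeDist, if_true]; omega⟩
      · simp only [starlikeDist, h, if_false] at hn
        by_cases h0 : (j' : ℕ) = 0
        · exact ⟨none, starlike_adj_none_some.2 h0, by simp only [starlikeDist]; omega⟩
        · obtain ⟨l, hl⟩ := h_in i' j' h0
          exact ⟨some ⟨i', l⟩, starlike_adj_some_some.2 ⟨rfl, by omega⟩,
            by simp only [starlikeDist, h, if_false]; omega⟩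

theorem two_mul_sum_range_min_add_one {j m : ℕ} (h : j < m) :
    2 * ∑ u ∈ Finset.range m, ((min j u : ℕ) + 1 : ℤ) = (j + 1) * (2 * m - j) := by
  have h_low : ∀ n ≤ j + 1, 2 * ∑ u ∈ Finset.range n, ((min j u : ℕ) + 1 : ℤ) = n * (n + 1) := by
    intro n hn
    induction n with
    | zero => simp
    | succ n ih =>
      rw [Finset.sum_range_succ, mul_add, ih (by omega), min_eq_right (by omega)]
      push_cast
      ring
  induction m, h using Nat.le_induction with
  | base =>
    rw [h_low _ le_rfl]
    push_cast
    ring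
  | succ m hm ih =>
    rw [Finset.sum_range_succ, mul_add, ih, min_eq_left (by omega)]
    push_cast
    ring

theorem sum_starlikeDist_arm (i l : Fin t) (j : Fin (k i)) :
    (∑ u : Fin (k l), starlikeDist (some ⟨i, j⟩) (some ⟨l, u⟩) : ℤ) =
      ∑ u : Fin (k l), (starlikeDist (k := k) none (some ⟨l, u⟩) : ℤ) + (j + 1) * k l -
        if i = l then (j + 1) * (2 * k i - j : ℤ) else 0 := by
  split_ifs with h
  · subst h
    rw [← two_mul_sum_range_min_add_one j.2,
      Finset.sum_range fun u => ((min (j : ℕ) u : ℕ) + 1 : ℤ), Finset.mul_sum,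
      show ((j : ℤ) + 1) * k i = ∑ _u : Fin (k i), ((j : ℤ) + 1) by simp [mul_comm],
      ← Finset.sum_add_distrib, ← Finset.sum_sub_distrib]
    refine Finset.sum_congr rfl fun u _ => ?_
    simp only [starlikeDist, if_true]
    omega
  · rw [show ((j : ℤ) + 1) * k l = ∑ _u : Fin (k l), ((j : ℤ) + 1) by simp [mul_comm],
      sub_zero, ← Finset.sum_add_distrib]
    refine Finset.sum_congr rfl fun u _ => ?_
    simp only [starlikeDist, h, if_false]
    push_cast
    ring

/-- The transmission of the vertex at distance `j + 1` from the center on the `i`-th arm,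
relative to the transmission of the center. -/
theorem transmission_starlike_some (i : Fin t) (j : Fin (k i)) :
    (transmission (starlike t k) (some ⟨i, j⟩) : ℤ) =
      transmission (starlike t k) none + (j + 1) * (∑ l, (k l : ℤ) - 2 * k i + (j + 1)) := by
  simp only [transmission, starlike_dist, Fintype.sum_option, Fintype.sum_sigma]
  push_cast
  simp only [sum_starlikeDist_arm, Finset.sum_sub_distrib, Finset.sum_add_distrib,
    Finset.sum_ite_eq, Finset.mem_univ, if_true, ← Finset.mul_sum]
  simp only [starlikeDist]
  push_cast
  ring

end Starlike

/-- The excess of the transmission at distance `d` from the center on the arm of length `a + i`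
of `T(a, a+1, a+2)` over that of the center is `d * (d + a + 3 - 2 * i)`; two such values on
different arms agree only if `a` is even. -/
theorem excess_injective {a : ℤ} (ha : 1 ≤ a) (h_odd : Odd a) {i i' d d' : ℤ}
    (hi : 0 ≤ i) (hii' : i ≤ i') (hi' : i' ≤ 2) (hd : 1 ≤ d) (hd' : 1 ≤ d')
    (h : d * (d + a + 3 - 2 * i) = d' * (d' + a + 3 - 2 * i')) : i = i' ∧ d = d' := by
  obtain ⟨m, rfl⟩ : ∃ m, d' = d + m := ⟨d' - d, by ring⟩
  have hmul : m * (2 * d + m + a + 3 - 2 * i') = 2 * d * (i' - i) := by linarith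
  have hpos : 0 < 2 * d + m + a + 3 - 2 * i' := by linarith
  have hm : 0 ≤ m := by
    by_contra! hm
    nlinarith [mul_nonneg (by linarith : 0 ≤ 2 * d) (sub_nonneg.2 hii')]
  have hm2 : m < 2 := by
    by_contra! hm2
    nlinarith
  obtain ⟨b, rfl⟩ := h_odd
  interval_cases m
  · have : i' - i = 0 := by
      rcases mul_eq_zero.1 (show 2 * d * (i' - i) = 0 by linarith) with h | h <;> linarith
    exact ⟨by linarith, by ring⟩
  · exfalso
    obtain h | h | h : i' - i = 0 ∨ i' - i = 1 ∨ i' - i = 2 := by omega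
    all_goals rw [h] at hmul; omega

/-- `T(a, a+1, a+2)` is transmission irregular if and only if `a` is odd. -/
theorem stmt_8 (a : ℕ) (ha : 1 ≤ a) :
    TransmissionIrregular (starlike 3 (fun i : Fin 3 => a + i.val)) ↔ Odd a := by
  have h_tr : ∀ (i : Fin 3) (j : Fin (a + i.val)),
      (transmission (starlike 3 (fun i : Fin 3 => a + i.val)) (some ⟨i, j⟩) : ℤ) =
        transmission (starlike 3 (fun i : Fin 3 => a + i.val)) none +
          ((j : ℤ) + 1) * (((j : ℤ) + 1) + a + 3 - 2 * ((i : ℕ) : ℤ)) := by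
    intro i j
    rw [transmission_starlike_some (k := fun i : Fin 3 => a + i.val), Fin.sum_univ_three]
    push_cast
    simp only [Fin.val_zero, Fin.val_one, Fin.val_two]
    push_cast
    ring
  have h_pos : ∀ (i : Fin 3) (j : Fin (a + i.val)),
      transmission (starlike 3 (fun i : Fin 3 => a + i.val)) none ≠
        transmission (starlike 3 (fun i : Fin 3 => a + i.val)) (some ⟨i, j⟩) := by
    intro i j h
    have hij := h_tr i j
    rw [← h] at hij
    have := mul_pos (by omega : (0 : ℤ) < j + 1)
      (by omega : (0 : ℤ) < ((j : ℤ) + 1) + a + 3 - 2 * ((i : ℕ) : ℤ))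
    linarith
  constructor
  · intro h_irr
    by_contra h_even
    obtain ⟨b, rfl⟩ := Nat.not_odd_iff_even.1 h_even
    have h_eq : transmission (starlike 3 (fun i : Fin 3 => b + b + i.val))
          (some ⟨0, ⟨b - 1, by omega⟩⟩) =
        transmission (starlike 3 (fun i : Fin 3 => b + b + i.val))
          (some ⟨2, ⟨b, by omega⟩⟩) := by
      zify
      rw [h_tr, h_tr]
      simp only [Fin.val_zero, Fin.val_two]
      push_cast [show 1 ≤ b by omega]
      ring
    simpa using h_irr h_eq
  · intro h_odd x y hxy
    have h_arm : ∀ (i i' : Fin 3) (j : Fin (a + i.val)) (j' : Fin (a + i'.val)), i ≤ i' →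
        transmission (starlike 3 (fun i : Fin 3 => a + i.val)) (some ⟨i, j⟩) =
          transmission (starlike 3 (fun i : Fin 3 => a + i.val)) (some ⟨i', j'⟩) →
        (some ⟨i, j⟩ : Option (Σ i : Fin 3, Fin (a + i.val))) = some ⟨i', j'⟩ := by
      intro i i' j j' hle h
      zify at h
      rw [h_tr, h_tr] at h
      obtain ⟨hi, hj⟩ := excess_injective (by omega) (by exact_mod_cast h_odd)
        (by omega) (by exact_mod_cast hle) (by omega) (by omega) (by omega) (add_left_cancel h)
      obtain rfl : i = i' := by omega
      obtain rfl : j = j' := by omega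
      rfl
    rcases x with _ | ⟨i, j⟩ <;> rcases y with _ | ⟨i', j'⟩
    · rfl
    · exact absurd hxy (h_pos i' j')
    · exact absurd hxy.symm (h_pos i j)
    · rcases le_total i i' with hle | hle
      · exact h_arm i i' j j' hle hxy
      · exact (h_arm i' i j' j hle hxy.symm).symm
end

section
/- Let a >= 2 be an integer and let G = C_3(a-1, a, a+1) be the unicyclic graph obtained from a triangle by attaching pendant paths of lengths a-1, a and a+1 at its three distinct vertices (one path per vertex); G is the line graph of the starlike tree T(a, a+1, a+2). Then G is transmission irregular if and only if a is even. -/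
/-- The graph obtained from a triangle (vertices `Sum.inl 0`, `Sum.inl 1`, `Sum.inl 2`)
by attaching `t` pairwise disjoint pendant paths: the `j`-th path has length `L j` and
is attached at the triangle vertex `c j`; `Sum.inr ⟨j, m⟩` is the vertex at distance
`m + 1` from the triangle along the `j`-th path. -/
def triWithPaths (t : ℕ) (L : Fin t → ℕ) (c : Fin t → Fin 3) :
    SimpleGraph (Fin 3 ⊕ Σ j : Fin t, Fin (L j)) :=
  SimpleGraph.fromRel (fun x y =>
    (∃ i i' : Fin 3, x = Sum.inl i ∧ y = Sum.inl i' ∧ i ≠ i') ∨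
    (∃ j : Fin t, ∃ m : Fin (L j), x = Sum.inl (c j) ∧ y = Sum.inr ⟨j, m⟩ ∧
      (m : ℕ) = 0) ∨
    (∃ j : Fin t, ∃ m m' : Fin (L j), x = Sum.inr ⟨j, m⟩ ∧ y = Sum.inr ⟨j, m'⟩ ∧
      (m' : ℕ) = (m : ℕ) + 1))

open Finset

/-- A function that is `1`-Lipschitz along edges, vanishes only at `v`, and can be decreased by
moving to a neighbour wherever it is nonzero is the distance from `v`. -/
theorem SimpleGraph.dist_eq_of_descent {V : Type*} (G : SimpleGraph V) (v : V) (f : V → ℕ)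
    (h0 : ∀ u, f u = 0 ↔ u = v) (hlip : ∀ x y, G.Adj x y → f y ≤ f x + 1)
    (hdesc : ∀ u, f u ≠ 0 → ∃ w, G.Adj w u ∧ f w + 1 = f u) (u : V) :
    G.dist v u = f u := by
  have hwalk : ∀ n u, f u = n → ∃ p : G.Walk v u, p.length = n := by
    intro n
    induction n with
    | zero =>
      intro u hu
      obtain rfl := (h0 u).1 hu
      exact ⟨.nil, rfl⟩
    | succ n ih =>
      intro u hu
      obtain ⟨w, hw, hfw⟩ := hdesc u (by omega)
      obtain ⟨p, hp⟩ := ih w (by omega)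
      exact ⟨p.concat hw, by simp [hp]⟩
  have hlower : ∀ x y, ∀ p : G.Walk x y, f y ≤ f x + p.length := by
    intro x y p
    induction p with
    | nil => simp
    | cons h p ih =>
      have := hlip _ _ h
      simp only [SimpleGraph.Walk.length_cons]
      omega
  obtain ⟨p, hp⟩ := hwalk _ u rfl
  apply le_antisymm (hp ▸ SimpleGraph.dist_le p)
  obtain ⟨q, hq⟩ := SimpleGraph.Reachable.exists_walk_length_eq_dist ⟨p⟩
  have := hlower _ _ q
  rwa [(h0 v).2 rfl, zero_add, hq] at this

namespace TriWithPaths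

variable {L : Fin 3 → ℕ}

/-- The triangle vertex closest to a given vertex. -/
def branch : (Fin 3 ⊕ Σ j : Fin 3, Fin (L j)) → Fin 3
  | .inl i => i
  | .inr ⟨j, _⟩ => j

/-- The distance of a vertex from the triangle. -/
def depth : (Fin 3 ⊕ Σ j : Fin 3, Fin (L j)) → ℕ
  | .inl _ => 0
  | .inr ⟨_, m⟩ => m + 1

/-- The distance between the vertices at depths `d` and `e` on the branches `i` and `j`. -/
def branchDist (i : Fin 3) (d : ℕ) (j : Fin 3) (e : ℕ) : ℕ :=
  if i = j then (d - e) + (e - d) else d + e + 1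

theorem depth_le (x : Fin 3 ⊕ Σ j : Fin 3, Fin (L j)) : depth x ≤ L (branch x) := by
  rcases x with i | ⟨j, m⟩
  · exact Nat.zero_le _
  · exact m.2

theorem exists_vertex (i : Fin 3) (d : ℕ) (h : d ≤ L i) :
    ∃ x : Fin 3 ⊕ Σ j : Fin 3, Fin (L j), branch x = i ∧ depth x = d := by
  cases d with
  | zero => exact ⟨.inl i, rfl, rfl⟩
  | succ d => exact ⟨.inr ⟨i, ⟨d, h⟩⟩, rfl, rfl⟩

theorem vertex_ext {x y : Fin 3 ⊕ Σ j : Fin 3, Fin (L j)} (hb : branch x = branch y)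
    (hd : depth x = depth y) : x = y := by
  rcases x with i | ⟨j, m⟩ <;> rcases y with i' | ⟨j', m'⟩ <;> simp only [branch, depth] at hb hd
  · rw [hb]
  · omega
  · omega
  · subst hb
    obtain rfl : m = m' := Fin.ext (by omega)
    rfl

theorem adj_iff (x y : Fin 3 ⊕ Σ j : Fin 3, Fin (L j)) :
    (triWithPaths 3 L ![0, 1, 2]).Adj x y ↔
      (branch x ≠ branch y ∧ depth x = 0 ∧ depth y = 0) ∨
      (branch x = branch y ∧ (depth y = depth x + 1 ∨ depth x = depth y + 1)) := by
  have hc : (![0, 1, 2] : Fin 3 → Fin 3) = id := by decide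
  rw [hc, triWithPaths, SimpleGraph.fromRel_adj]
  rcases x with i | ⟨j, m⟩ <;> rcases y with i' | ⟨j', m'⟩
  · simp [branch, depth]
    grind
  · simp [branch, depth]
    constructor
    · rintro ⟨m, ⟨rfl, h⟩, h'⟩
      simp_all
    · rintro ⟨rfl, h⟩
      exact ⟨m', by simp [h]⟩
  · simp [branch, depth]
    constructor
    · rintro ⟨m, ⟨rfl, h⟩, h'⟩
      simp_all
    · rintro ⟨rfl, h⟩
      exact ⟨m, by simp [h]⟩
  · by_cases h : j = j'
    · subst h
      simp [branch, depth]
      constructor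
      · rintro ⟨-, ⟨k, n, ⟨rfl, h1⟩, n', ⟨-, h2⟩, h3⟩ | ⟨k, n, ⟨rfl, h1⟩, n', ⟨-, h2⟩, h3⟩⟩ <;>
          simp_all
      · intro h
        refine ⟨fun e => by subst e; omega, ?_⟩
        rcases h with h | h
        · exact .inl ⟨j, m, ⟨rfl, .rfl⟩, m', ⟨rfl, .rfl⟩, h⟩
        · exact .inr ⟨j, m', ⟨rfl, .rfl⟩, m, ⟨rfl, .rfl⟩, h⟩
    · simp [branch, depth, h]
      grind

theorem dist_eq (x y : Fin 3 ⊕ Σ j : Fin 3, Fin (L j)) :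
    (triWithPaths 3 L ![0, 1, 2]).dist x y =
      branchDist (branch x) (depth x) (branch y) (depth y) := by
  refine SimpleGraph.dist_eq_of_descent _ x
    (fun y => branchDist (branch x) (depth x) (branch y) (depth y)) ?_ ?_ ?_ y
  · intro u
    constructor
    · intro h
      simp only [branchDist] at h
      split_ifs at h with hb
      exact vertex_ext hb.symm (by omega)
    · rintro rfl
      simp [branchDist]
  · intro u w h
    rw [adj_iff] at h
    simp only [branchDist]
    grind
  · intro u hu
    have hx := depth_le x
    have hu' := depth_le u
    simp only [branchDist] at hu ⊢
    simp only [adj_iff]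
    by_cases hb : branch x = branch u
    · rw [if_pos hb] at hu ⊢
      rcases lt_or_ge (depth x) (depth u) with hlt | hge
      · obtain ⟨w, hw, hd⟩ := exists_vertex (L := L) (branch u) (depth u - 1) (by omega)
        refine ⟨w, .inr ⟨hw, by omega⟩, ?_⟩
        rw [if_pos (hb.trans hw.symm)]
        omega
      · obtain ⟨w, hw, hd⟩ := exists_vertex (L := L) (branch u) (depth u + 1)
          (by rw [hb] at hx; omega)
        refine ⟨w, .inr ⟨hw, by omega⟩, ?_⟩
        rw [if_pos (hb.trans hw.symm)]
        omega
    · rw [if_neg hb]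
      rcases Nat.eq_zero_or_pos (depth u) with h0 | hpos
      · obtain ⟨w, hw, hd⟩ := exists_vertex (L := L) (branch x) 0 (Nat.zero_le _)
        refine ⟨w, .inl ⟨by rwa [hw], hd, h0⟩, ?_⟩
        rw [if_pos hw.symm]
        omega
      · obtain ⟨w, hw, hd⟩ := exists_vertex (L := L) (branch u) (depth u - 1) (by omega)
        refine ⟨w, .inr ⟨hw, by omega⟩, ?_⟩
        rw [if_neg (by rwa [hw])]
        omega

theorem sum_branch_depth (g : Fin 3 → ℕ → ℕ) :
    ∑ x : Fin 3 ⊕ Σ j : Fin 3, Fin (L j), g (branch x) (depth x) =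
      ∑ j, ∑ e ∈ range (L j + 1), g j e := by
  rw [Fintype.sum_sum_type, Fintype.sum_sigma, ← sum_add_distrib]
  refine sum_congr rfl fun j _ => ?_
  rw [sum_range_succ', add_comm, ← Fin.sum_univ_eq_sum_range (fun e => g j (e + 1))]
  rfl

theorem sum_range_add (d k : ℕ) :
    2 * ((∑ e ∈ range (k + 1), (d + e + 1) : ℕ) : ℤ) = (k + 1) * (k + 2 * d + 2) := by
  induction k with
  | zero => simp; ring
  | succ k ih =>
    rw [sum_range_succ]
    push_cast at ih ⊢
    linarith

theorem sum_range_dist (d k : ℕ) (h : d ≤ k) :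
    2 * ((∑ e ∈ range (k + 1), ((d - e) + (e - d)) : ℕ) : ℤ) =
      2 * d ^ 2 - 2 * k * d + k * (k + 1) := by
  induction k, h using Nat.le_induction with
  | base =>
    have hrefl : ∑ e ∈ range (d + 1), ((d - e) + (e - d)) = ∑ e ∈ range (d + 1), e := by
      rw [← sum_range_reflect]
      refine sum_congr rfl fun e he => ?_
      rw [mem_range] at he
      omega
    have h2 := sum_range_id_mul_two (d + 1)
    rw [hrefl]
    zify at h2
    simp at h2
    push_cast
    linarith
  | succ k h ih =>
    rw [sum_range_succ]
    have hk : d - (k + 1) + (k + 1 - d) = k + 1 - d := by omega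
    rw [hk, Nat.cast_add, Nat.cast_sub (by omega)]
    push_cast at ih ⊢
    linarith

theorem two_mul_transmission (a : ℕ) (ha : 2 ≤ a)
    (x : Fin 3 ⊕ Σ j : Fin 3, Fin (![a - 1, a, a + 1] j)) :
    2 * (transmission (triWithPaths 3 ![a - 1, a, a + 1] ![0, 1, 2]) x : ℤ) =
      2 * (depth x) ^ 2 + 2 * depth x * (a + 4 - 2 * (branch x : ℕ)) - 2 * (branch x : ℕ)
        + (3 * a ^ 2 + 7 * a + 8) := by
  have hd := depth_le x
  simp only [transmission, dist_eq]
  rw [sum_branch_depth (branchDist (branch x) (depth x))]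
  generalize depth x = d at *
  generalize branch x = i at *
  obtain ⟨c, rfl⟩ : ∃ c, a = c + 1 := ⟨a - 1, by omega⟩
  rw [Fin.sum_univ_three]
  have h0 := sum_range_add d c
  have h1 := sum_range_add d (c + 1)
  have h2 := sum_range_add d (c + 1 + 1)
  fin_cases i
  · have h := sum_range_dist d c hd
    simp [branchDist] at h h0 h1 h2 ⊢
    linarith
  · have h := sum_range_dist d (c + 1) hd
    simp [branchDist] at h h0 h1 h2 ⊢
    linarith
  · have h := sum_range_dist d (c + 1 + 1) hd
    simp [branchDist] at h h0 h1 h2 ⊢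
    linarith

theorem ne_of_branch_succ (a d e : ℤ) (ha : 0 < a) (hd : 0 ≤ d) (he : 0 ≤ e) :
    d ^ 2 + d * (a + 2) + 1 ≠ e ^ 2 + e * a := by
  intro h
  rcases le_or_gt e d with hle | hlt
  · nlinarith
  · have hmul : 0 ≤ (e - d - 1) * (e + d + 1 + a) := mul_nonneg (by omega) (by omega)
    linarith

theorem eq_of_branch_add_two (a d e : ℤ) (ha : 0 ≤ a) (hd : 0 ≤ d) (he : 0 ≤ e)
    (h : d ^ 2 + d * (a + 4) + 2 = e ^ 2 + e * a) : a = 2 * d + 1 := by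
  rcases lt_trichotomy e (d + 1) with hlt | rfl | hgt
  · nlinarith
  · linarith
  · nlinarith

end TriWithPaths

open TriWithPaths in
/-- Let `a ≥ 2` and let `G = C₃(a-1, a, a+1)` be the unicyclic graph (the line graph of
the starlike tree `T(a, a+1, a+2)`) obtained from a triangle by attaching pendant paths
of lengths `a-1`, `a` and `a+1` at its three vertices, one path per vertex. Then `G` is
transmission irregular if and only if `a` is even. -/
theorem stmt_17 (a : ℕ) (ha : 2 ≤ a) :
    TransmissionIrregular (triWithPaths 3 ![a - 1, a, a + 1] ![0, 1, 2]) ↔ Even a := by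
  constructor
  · intro hinj
    by_contra hodd
    obtain ⟨k, rfl⟩ := Nat.not_even_iff_odd.1 hodd
    obtain ⟨x, hxb, hxd⟩ := exists_vertex (L := ![2 * k + 1 - 1, 2 * k + 1, 2 * k + 1 + 1])
      0 k (by simp; omega)
    obtain ⟨y, hyb, hyd⟩ := exists_vertex (L := ![2 * k + 1 - 1, 2 * k + 1, 2 * k + 1 + 1])
      2 (k + 1) (by simp; omega)
    have hx := two_mul_transmission _ ha x
    have hy := two_mul_transmission _ ha y
    rw [hxb, hxd] at hx
    rw [hyb, hyd] at hy
    have hxy : x = y := hinj (by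
      rw [Fin.val_zero] at hx
      rw [Fin.val_two] at hy
      push_cast at hx hy
      zify
      linarith)
    rw [hxy, hyb] at hxb
    exact absurd hxb (by decide)
  · intro heven x y hxy
    have hx := two_mul_transmission _ ha x
    have hy := two_mul_transmission _ ha y
    rw [hxy, hy] at hx
    have ha0 : (2 : ℤ) ≤ a := by exact_mod_cast ha
    have hd0 : (0 : ℤ) ≤ depth x := Int.natCast_nonneg _
    have he0 : (0 : ℤ) ≤ depth y := Int.natCast_nonneg _
    have hodd (d : ℕ) (h : (a : ℤ) = 2 * d + 1) : False := by
      obtain ⟨k, rfl⟩ := heven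
      omega
    have hb : branch x = branch y := by
      clear hy hxy
      revert hx
      generalize branch x = i
      generalize branch y = j
      intro hx
      fin_cases i <;> fin_cases j <;> simp at hx ⊢
      · exact ne_of_branch_succ (a + 2) (depth x) (depth y) (by omega) hd0 he0 (by linarith)
      · exact hodd _ (eq_of_branch_add_two a (depth x) (depth y) (by omega) hd0 he0 (by linarith))
      · exact ne_of_branch_succ (a + 2) (depth y) (depth x) (by omega) he0 hd0 (by linarith)
      · exact ne_of_branch_succ a (depth x) (depth y) (by omega) hd0 he0 (by linarith)
      · exact hodd _ (eq_of_branch_add_two a (depth y) (depth x) (by omega) he0 hd0 (by linarith))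
      · exact ne_of_branch_succ a (depth y) (depth x) (by omega) he0 hd0 (by linarith)
    refine vertex_ext hb ?_
    rw [hb] at hx
    have hlt := (branch y).isLt
    have hmul : ((depth x : ℤ) - depth y) *
        (depth x + depth y + (a + 4 - 2 * (branch y : ℕ))) = 0 := by
      linarith
    rcases mul_eq_zero.1 hmul with h | h <;> omega
end
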